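/- Let k ∈ ℕ ∪ {∞} and let X be a Banach space with the property that for every Lipschitz function f : X → ℝ and every η > 0 there exists a function g : X → ℝ of class C^k on X such that |f − g| ≤ η on X and lip(g, B(x₀,r)) ≤ lip(f, B(x₀, r+η)) + η for every closed ball B(x₀,r) ⊂ X. Then, if Ω is an open subset of X, u₀ : cl(Ω) → ℝ is a Lipschitz function with lip(u₀, ∂Ω) < lip(u₀, cl(Ω)), and ε > 0, there exists a function v : cl(Ω) → ℝ such that v is of class C^k on Ω, v is Lipschitz on cl(Ω) with lip(v, cl(Ω)) ≤ lip(u₀, cl(Ω)), v = u₀ on ∂Ω, and |u₀ − v| ≤ ε on cl(Ω). -/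

import Mathlib

open Metric Set MeasureTheory

/-- `lipOn f s` is the Lipschitz constant of `f` on `s`:
the infimum of all `L > 0` such that `|f x - f y| ≤ L * dist x y` for all `x, y ∈ s`. -/
noncomputable def lipOn {X : Type*} [PseudoMetricSpace X] (f : X → ℝ) (s : Set X) : ℝ :=
  sInf {L : ℝ | 0 < L ∧ ∀ x ∈ s, ∀ y ∈ s, |f x - f y| ≤ L * dist x y}

/-- `f` is `K`-Lipschitz on `s`. -/
def IsLipschitzWithOn {X : Type*} [PseudoMetricSpace X] (K : ℝ) (f : X → ℝ) (s : Set X) : Prop :=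
  ∀ x ∈ s, ∀ y ∈ s, |f x - f y| ≤ K * dist x y
open Topology Filter

section PseudoMetric

variable {X : Type*} [PseudoMetricSpace X]

lemma IsLipschitzWithOn.mono {K K' : ℝ} {f : X → ℝ} {s t : Set X} (h : IsLipschitzWithOn K f s)
    (hK : K ≤ K') (hst : t ⊆ s) : IsLipschitzWithOn K' f t := fun x hx y hy =>
  (h x (hst hx) y (hst hy)).trans (mul_le_mul_of_nonneg_right hK dist_nonneg)

lemma IsLipschitzWithOn.lipschitzOnWith {K : ℝ} {f : X → ℝ} {s : Set X}
    (h : IsLipschitzWithOn K f s) (hK : 0 ≤ K) : LipschitzOnWith ⟨K, hK⟩ f s :=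
  LipschitzOnWith.of_dist_le_mul h

lemma LipschitzWith.isLipschitzWithOn {K : NNReal} {f : X → ℝ} (h : LipschitzWith K f)
    (s : Set X) : IsLipschitzWithOn K f s := fun x _ y _ => h.dist_le_mul x y

lemma lipOn_nonneg (f : X → ℝ) (s : Set X) : 0 ≤ lipOn f s :=
  Real.sInf_nonneg fun _ h => h.1.le

lemma lipOn_le {K : ℝ} {f : X → ℝ} {s : Set X} (h : IsLipschitzWithOn K f s) (hK : 0 ≤ K) :
    lipOn f s ≤ K := by
  refine le_of_forall_pos_le_add fun δ hδ => csInf_le ⟨0, fun _ h => h.1.le⟩ ⟨by positivity, ?_⟩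
  exact h.mono (by linarith) le_rfl

lemma isLipschitzWithOn_lipOn {f : X → ℝ} {s : Set X} (h : ∃ K, IsLipschitzWithOn K f s) :
    IsLipschitzWithOn (lipOn f s) f s := by
  obtain ⟨K, hK⟩ := h
  intro x hx y hy
  have hne : {L : ℝ | 0 < L ∧ ∀ x ∈ s, ∀ y ∈ s, |f x - f y| ≤ L * dist x y}.Nonempty :=
    ⟨max K 1, by positivity, hK.mono (le_max_left _ _) le_rfl⟩
  refine le_of_forall_pos_le_add fun δ hδ => ?_
  have hd : 0 < dist x y + 1 := by positivity
  obtain ⟨L, hL, hlt⟩ := exists_lt_of_csInf_lt hne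
    (lt_add_of_pos_right (lipOn f s) (div_pos hδ hd))
  calc |f x - f y| ≤ L * dist x y := hL.2 x hx y hy
    _ ≤ (lipOn f s + δ / (dist x y + 1)) * dist x y := by gcongr
    _ = lipOn f s * dist x y + δ * (dist x y / (dist x y + 1)) := by ring
    _ ≤ lipOn f s * dist x y + δ * 1 := by
      gcongr
      rw [div_le_one hd]
      linarith
    _ = _ := by ring

end PseudoMetric

/-- A function on a normed space whose pointwise Lipschitz constant is everywhere at most `L`
is `L`-Lipschitz. -/
lemma isLipschitzWithOn_univ_of_eventually {X : Type*} [NormedAddCommGroup X] [NormedSpace ℝ X]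
    {v : X → ℝ} {L : ℝ}
    (h : ∀ p, ∀ K, L < K → ∀ᶠ q in 𝓝 p, |v q - v p| ≤ K * dist q p) :
    IsLipschitzWithOn L v univ := by
  have hcont : Continuous v := by
    rw [continuous_iff_continuousAt]
    intro p
    rw [ContinuousAt, tendsto_iff_dist_tendsto_zero]
    refine squeeze_zero' (Eventually.of_forall fun _ => dist_nonneg)
      (h p (L + 1) (by linarith)) ?_
    have : Continuous fun q => (L + 1) * dist q p := by fun_prop
    simpa using this.tendsto p
  have key : ∀ x y, v y ≤ v x + L * dist x y := by
    intro x y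
    set γ : ℝ → X := fun t => x + t • (y - x) with hγ
    have hγc : Continuous γ := by fun_prop
    have hγd : ∀ s t, dist (γ s) (γ t) = |s - t| * dist x y := by
      intro s t
      rw [dist_eq_norm, hγ]
      simp only [add_sub_add_left_eq_sub, ← sub_smul, norm_smul, Real.norm_eq_abs]
      rw [dist_comm, dist_eq_norm]
    have := image_le_of_liminf_slope_right_le_deriv_boundary (f := v ∘ γ) (a := 0) (b := 1)
      (B := fun t => v x + (L * dist x y) * t) (B' := fun _ => L * dist x y)
      (hcont.comp hγc).continuousOn (by simp [hγ]) (by fun_prop)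
      (fun t _ => by
        simpa using (((hasDerivAt_id t).const_mul (L * dist x y)).const_add
          (v x)).hasDerivWithinAt)
      (fun t _ r hr => by
        refine Eventually.frequently ?_
        obtain ⟨K, hK, hKr⟩ : ∃ K, L < K ∧ K * dist x y < r := by
          have hd : 0 < dist x y + 1 := by positivity
          refine ⟨L + (r - L * dist x y) / (dist x y + 1), by
            have := div_pos (sub_pos.2 hr) hd
            linarith, ?_⟩
          have : (r - L * dist x y) * (dist x y / (dist x y + 1)) < (r - L * dist x y) * 1 :=
            mul_lt_mul_of_pos_left ((div_lt_one hd).2 (by linarith)) (sub_pos.2 hr)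
          calc _ = L * dist x y + (r - L * dist x y) * (dist x y / (dist x y + 1)) := by ring
            _ < r := by linarith
        have h1 := (hγc.tendsto t).eventually (h (γ t) K hK)
        filter_upwards [nhdsWithin_le_nhds h1, self_mem_nhdsWithin] with s hs hst
        have hst' : 0 < s - t := sub_pos.2 hst
        rw [hγd, abs_of_pos hst'] at hs
        rw [slope_def_field, div_lt_iff₀ hst']
        calc (v ∘ γ) s - (v ∘ γ) t ≤ K * ((s - t) * dist x y) := (le_abs_self _).trans hs
          _ = (K * dist x y) * (s - t) := by ring
          _ < r * (s - t) := by gcongr)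
      (right_mem_Icc.2 zero_le_one)
    simpa [hγ] using this
  intro x _ y _
  have h1 := key x y
  have h2 := key y x
  rw [dist_comm] at h2
  rw [abs_le]
  constructor <;> linarith

lemma exists_arctan_sub_eq {M a b : ℝ} (ha : |a| ≤ M) (hb : |b| ≤ M) :
    ∃ t, 1 / (1 + M ^ 2) ≤ t ∧ t ≤ 1 ∧ Real.arctan a - Real.arctan b = t * (a - b) := by
  wlog hab : b ≤ a generalizing a b
  · obtain ⟨t, h1, h2, h3⟩ := this hb ha (le_of_not_ge hab)
    exact ⟨t, h1, h2, by linarith⟩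
  rcases hab.eq_or_lt with rfl | hab
  · have : 1 / (1 + M ^ 2) ≤ 1 := by
      rw [div_le_one (by positivity)]
      nlinarith
    exact ⟨1, this, le_rfl, by simp⟩
  obtain ⟨c, hc, hc'⟩ := exists_hasDerivAt_eq_slope Real.arctan _ hab
    Real.continuous_arctan.continuousOn (fun x _ => Real.hasDerivAt_arctan x)
  have hcM : |c| ≤ M := abs_le.2
    ⟨by linarith [hc.1, (abs_le.1 hb).1], by linarith [hc.2, (abs_le.1 ha).2]⟩
  have hc2 : c ^ 2 ≤ M ^ 2 := sq_le_sq' (abs_le.1 hcM).1 (abs_le.1 hcM).2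
  refine ⟨1 / (1 + c ^ 2), by gcongr, ?_, ?_⟩
  · rw [div_le_one (by positivity)]
    nlinarith
  · rw [hc', div_mul_cancel₀ _ (sub_pos.2 hab).ne']

lemma abs_arctan_le_two (x : ℝ) : |Real.arctan x| ≤ 2 := by
  have h1 := Real.arctan_lt_pi_div_two x
  have h2 := Real.neg_pi_div_two_lt_arctan x
  have h3 := Real.pi_le_four
  rw [abs_le]
  constructor <;> linarith

/-- An `L`-Lipschitz function agreeing on `s` with some `L'`-Lipschitz function, where `L' < L`,
can be approximated uniformly by an `L`-Lipschitz function with the same values on `s` and whose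
Lipschitz constant on every ball is strictly smaller than `L`. -/
lemma exists_isLipschitzWithOn_lt {X : Type*} [NormedAddCommGroup X] {L L' ε : ℝ} (hL' : 0 ≤ L')
    (hLL' : L' < L) (hε : 0 < ε) {f w : X → ℝ} (hf : IsLipschitzWithOn L f univ)
    (hw : IsLipschitzWithOn L' w univ) :
    ∃ u : X → ℝ, (∀ x, f x = w x → u x = f x) ∧ (∀ x, |f x - u x| ≤ ε) ∧
      ∀ R, ∃ c, 0 < c ∧ c ≤ L ∧ IsLipschitzWithOn (L - c) u (closedBall 0 R) := by
  set δ := min 1 (ε / 2) with hδ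
  have hδ0 : 0 < δ := by positivity
  have hδ1 : δ ≤ 1 := min_le_left _ _
  refine ⟨fun x => f x - δ * Real.arctan (f x - w x), fun x hx => by simp [hx], fun x => ?_,
    fun R => ?_⟩
  · rw [sub_sub_cancel, abs_mul, abs_of_pos hδ0]
    calc δ * |Real.arctan (f x - w x)| ≤ (ε / 2) * 2 := by
          gcongr
          · exact min_le_right _ _
          · exact abs_arctan_le_two _
      _ = ε := by ring
  · set M := |f 0 - w 0| + (L + L') * R with hM
    have hb : ∀ x ∈ closedBall (0 : X) R, |f x - w x| ≤ M := by
      intro x hx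
      have h1 := hf x trivial 0 trivial
      have h2 := hw x trivial 0 trivial
      have h3 : (L + L') * dist x 0 ≤ (L + L') * R := by
        have : dist x 0 ≤ R := hx
        gcongr
        linarith
      have h4 : |f x - w x| ≤ |f 0 - w 0| + (|f x - f 0| + |w x - w 0|) := by
        rw [show f x - w x = (f 0 - w 0) + ((f x - f 0) - (w x - w 0)) by ring]
        exact (abs_add_le _ _).trans (add_le_add_right (abs_sub _ _) _)
      linarith
    have hm : 1 / (1 + M ^ 2) ≤ 1 := by
      rw [div_le_one (by positivity)]
      nlinarith
    have hm0 : 0 < 1 / (1 + M ^ 2) := by positivity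
    have hδm : δ * (1 / (1 + M ^ 2)) ≤ 1 := mul_le_one₀ hδ1 hm0.le hm
    refine ⟨δ * (1 / (1 + M ^ 2)) * (L - L'), by
      have := sub_pos.2 hLL'
      positivity, by nlinarith, ?_⟩
    intro x hx y hy
    obtain ⟨t, ht1, ht2, ht⟩ := exists_arctan_sub_eq (hb x hx) (hb y hy)
    have hδt : δ * t ≤ 1 := mul_le_one₀ hδ1 (hm0.le.trans ht1) ht2
    have hδt0 : 0 ≤ δ * t := mul_nonneg hδ0.le (hm0.le.trans ht1)
    have heq : f x - δ * Real.arctan (f x - w x) - (f y - δ * Real.arctan (f y - w y)) =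
        (1 - δ * t) * (f x - f y) + (δ * t) * (w x - w y) := by
      linear_combination (-δ) * ht
    rw [heq]
    calc |(1 - δ * t) * (f x - f y) + (δ * t) * (w x - w y)|
        ≤ (1 - δ * t) * |f x - f y| + (δ * t) * |w x - w y| := by
          refine (abs_add_le _ _).trans_eq ?_
          rw [abs_mul, abs_mul, abs_of_nonneg hδt0, abs_of_nonneg (sub_nonneg.2 hδt)]
      _ ≤ (1 - δ * t) * (L * dist x y) + (δ * t) * (L' * dist x y) := by
          have h1 := hf x trivial y trivial
          have h2 := hw x trivial y trivial
          have := sub_nonneg.2 hδt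
          gcongr
      _ = (L - δ * t * (L - L')) * dist x y := by ring
      _ ≤ _ := by
          have := (sub_pos.2 hLL').le
          gcongr

lemma exists_lipschitzWith_smoothTransition : ∃ M, LipschitzWith M Real.smoothTransition := by
  have hd : Differentiable ℝ Real.smoothTransition :=
    (Real.smoothTransition.contDiff (n := 1)).differentiable (by simp)
  have hc : Continuous (deriv Real.smoothTransition) :=
    (Real.smoothTransition.contDiff (n := 1)).continuous_deriv (by simp)
  obtain ⟨M, hM⟩ := (isCompact_Icc (a := (0 : ℝ)) (b := 1)).exists_bound_of_continuousOn
    hc.continuousOn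
  have hM0 : 0 ≤ M := (norm_nonneg _).trans (hM 0 (by simp))
  have h : LipschitzOnWith ⟨M, hM0⟩ Real.smoothTransition (Icc 0 1) :=
    Convex.lipschitzOnWith_of_nnnorm_deriv_le (fun x _ => hd x) hM (convex_Icc 0 1)
  have h2 := (lipschitzOnWith_iff_restrict.1 h).comp (LipschitzWith.projIcc zero_le_one)
  refine ⟨⟨M, hM0⟩ * 1, fun x y => ?_⟩
  simpa [Real.smoothTransition.projIcc] using h2 x y

/-- An open set is the positivity set of a nonnegative `1`-Lipschitz function which decays at
infinity. -/
lemma IsOpen.exists_isLipschitzWithOn_pos {X : Type*} [NormedAddCommGroup X]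
    {Ω : Set X} (hΩ : IsOpen Ω) : ∃ e : X → ℝ, IsLipschitzWithOn 1 e univ ∧ (∀ x ∈ Ω, 0 < e x) ∧
      (∀ x ∉ Ω, e x = 0) ∧ ∀ x, e x * ‖x‖ ≤ 1 := by
  obtain ⟨d, hd, hpos, hzero⟩ : ∃ d : X → ℝ, LipschitzWith 1 d ∧ (∀ x ∈ Ω, 0 < d x) ∧
      ∀ x ∉ Ω, d x = 0 := by
    rcases (Ωᶜ).eq_empty_or_nonempty with h | h
    · refine ⟨fun _ => 1, LipschitzWith.const' 1, fun _ _ => one_pos, fun x hx => ?_⟩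
      exact absurd (mem_compl hx) (h ▸ notMem_empty x)
    · refine ⟨fun x => infDist x Ωᶜ, lipschitz_infDist_pt _, fun x hx => ?_,
        fun x hx => infDist_zero_of_mem hx⟩
      exact (hΩ.isClosed_compl.notMem_iff_infDist_pos h).1 (not_not.2 hx)
  have hi : LipschitzWith 1 fun x : X => 1 / (1 + ‖x‖) := by
    refine LipschitzWith.of_dist_le_mul fun x y => ?_
    have hx : 0 < 1 + ‖x‖ := by positivity
    have hy : 0 < 1 + ‖y‖ := by positivity
    rw [Real.dist_eq, div_sub_div _ _ hx.ne' hy.ne', abs_div, abs_of_pos (mul_pos hx hy),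
      div_le_iff₀ (mul_pos hx hy), NNReal.coe_one, one_mul, one_mul]
    calc |1 + ‖y‖ - (1 + ‖x‖) * 1| = |‖y‖ - ‖x‖| := by ring_nf
      _ ≤ dist x y := by rw [dist_comm, dist_eq_norm]; exact abs_norm_sub_norm_le y x
      _ ≤ dist x y * ((1 + ‖x‖) * (1 + ‖y‖)) := le_mul_of_one_le_right dist_nonneg
          (one_le_mul_of_one_le_of_one_le (by simp) (by simp))
  refine ⟨fun x => min (d x) (1 / (1 + ‖x‖)), ?_, fun x hx => ?_, fun x hx => ?_, fun x => ?_⟩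
  · simpa using (hd.min hi).isLipschitzWithOn univ
  · have := hpos x hx
    positivity
  · simp only [hzero x hx]
    exact min_eq_left (by positivity)
  · calc min (d x) (1 / (1 + ‖x‖)) * ‖x‖ ≤ 1 / (1 + ‖x‖) * ‖x‖ := by
          gcongr
          exact min_le_right _ _
      _ ≤ 1 := by
          rw [one_div_mul_eq_div, div_le_one (by positivity)]
          linarith

lemma exists_pos_le_and_succ_le {θ : ℕ → ℝ} (hθ : ∀ n, 0 < θ n) :
    ∃ η : ℕ → ℝ, (∀ n, 0 < η n) ∧ (∀ n, η n ≤ θ n) ∧ ∀ n, η (n + 1) ≤ θ n :=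
  ⟨fun n => min (θ n) (θ (n - 1)), fun _ => lt_min (hθ _) (hθ _), fun _ => min_le_left _ _,
    fun _ => min_le_right _ _⟩

/-- The difference of a convex combination of `g` and `g'` with variable coefficients. -/
lemma abs_combination_sub_le {X : Type*} [PseudoMetricSpace X] {χ g g' : X → ℝ}
    {C K θ L : ℝ} {p q : X} (h0 : 0 ≤ χ p) (h1 : χ p ≤ 1) (hg : |g q - g p| ≤ K * dist q p) (hg' : |g' q - g' p| ≤ K * dist q p)
    (hχ : |χ q - χ p| ≤ C * dist q p) (hgg' : |g q - g' q| ≤ θ) (hL : K + C * θ ≤ L)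
    (hC : 0 ≤ C) :
    |χ q * g q + (1 - χ q) * g' q - (χ p * g p + (1 - χ p) * g' p)| ≤ L * dist q p := by
  have heq : χ q * g q + (1 - χ q) * g' q - (χ p * g p + (1 - χ p) * g' p) =
      χ p * (g q - g p) + (1 - χ p) * (g' q - g' p) + (χ q - χ p) * (g q - g' q) := by ring
  have h1' := sub_nonneg.2 h1
  rw [heq]
  calc _ ≤ χ p * |g q - g p| + (1 - χ p) * |g' q - g' p| + |χ q - χ p| * |g q - g' q| := by
        refine (abs_add_le _ _).trans (add_le_add ((abs_add_le _ _).trans_eq ?_) (abs_mul _ _).le)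
        rw [abs_mul, abs_mul, abs_of_nonneg h0, abs_of_nonneg h1']
    _ ≤ χ p * (K * dist q p) + (1 - χ p) * (K * dist q p) + (C * dist q p) * θ := by gcongr
    _ = (K + C * θ) * dist q p := by ring
    _ ≤ _ := by gcongr

lemma abs_sub_combination_le {s c x y δ : ℝ} (h0 : 0 ≤ c) (h1 : c ≤ 1) (hx : |s - x| ≤ δ)
    (hy : |s - y| ≤ δ) : |s - (c * x + (1 - c) * y)| ≤ δ := by
  rw [show s - (c * x + (1 - c) * y) = c * (s - x) + (1 - c) * (s - y) by ring]
  have h1' := sub_nonneg.2 h1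
  calc _ ≤ c * |s - x| + (1 - c) * |s - y| := by
        refine (abs_add_le _ _).trans_eq ?_
        rw [abs_mul, abs_mul, abs_of_nonneg h0, abs_of_nonneg h1']
    _ ≤ c * δ + (1 - c) * δ := by gcongr
    _ = δ := by ring

/-- Functions which are locally defined along a decreasing exhaustion of `{x | 0 < e x}` by
superlevel sets of `e` can be glued. -/
lemma exists_glue {X : Type*} [TopologicalSpace X] {e u : X → ℝ} (he : Continuous e)
    {a b : ℕ → ℝ} (ha : Tendsto a atTop (𝓝 0)) (ha0 : ∀ n, 0 < a n) (hab : ∀ n, b n < a n) (hba : ∀ n, a (n + 1) < b n)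
    {χ g : ℕ → X → ℝ} (h1 : ∀ n x, a n ≤ e x → χ n x = 1) (h0 : ∀ n x, e x ≤ b n → χ n x = 0) :
    ∃ v : X → ℝ, (∀ x, e x ≤ 0 → v x = u x) ∧ ∀ x, 0 < e x → ∃ n, a (n + 1) ≤ e x ∧
      v =ᶠ[𝓝 x] fun y => χ n y * g n y + (1 - χ n y) * g (n + 1) y := by
  classical
  set F : ℕ → X → ℝ := fun n y => χ n y * g n y + (1 - χ n y) * g (n + 1) y with hF
  have hanti : StrictAnti a := strictAnti_nat_of_succ_lt fun n => (hba n).trans (hab n)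
  set v : X → ℝ := fun x => if h : ∃ n, a (n + 1) ≤ e x then F (Nat.find h) x else u x with hv
  have hv_eq : ∀ x n, a (n + 1) ≤ e x → (∀ j < n, e x < a (j + 1)) → v x = F n x := by
    intro x n hn hj
    have hex : ∃ n, a (n + 1) ≤ e x := ⟨n, hn⟩
    have hfind : Nat.find hex = n := (Nat.find_eq_iff hex).2 ⟨hn, fun j hjn => not_le.2 (hj j hjn)⟩
    simp only [hv, dif_pos hex, hfind]
  refine ⟨v, fun x hx => dif_neg ?_, fun x hx => ?_⟩
  · rintro ⟨n, hn⟩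
    linarith [ha0 (n + 1)]
  have hex : ∃ n, a (n + 1) ≤ e x :=
    (((tendsto_add_atTop_iff_nat 1).2 ha).eventually (eventually_le_nhds hx)).exists
  obtain ⟨n, hn, hj⟩ : ∃ n, a (n + 1) ≤ e x ∧ ∀ j < n, e x < a (j + 1) :=
    ⟨Nat.find hex, Nat.find_spec hex, fun j hjn => not_le.1 (Nat.find_min hex hjn)⟩
  rcases hn.lt_or_eq with hlt | heq
  · refine ⟨n, hn, ?_⟩
    have hjn : ∀ᶠ y in 𝓝 x, ∀ j ∈ Set.Iio n, e y < a (j + 1) :=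
      (Filter.eventually_all_finite (Set.finite_Iio n)).2 fun j hjn =>
        he.continuousAt.eventually (gt_mem_nhds (hj j hjn))
    filter_upwards [he.continuousAt.eventually (lt_mem_nhds hlt), hjn] with y hy hy'
    exact hv_eq y n hy.le hy'
  · refine ⟨n + 1, (hanti (Nat.lt_succ_self _)).le.trans hn, ?_⟩
    have hlt : a (n + 2) < e x := (hanti (Nat.lt_succ_self (n + 1))).trans_le hn
    filter_upwards [he.continuousAt.eventually (lt_mem_nhds hlt),
      he.continuousAt.eventually (gt_mem_nhds (heq ▸ hba n))] with y hy hy'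
    have hyj : ∀ j < n, e y < a (j + 1) := fun j hjn =>
      (hy'.trans (hab n)).trans_le (hanti.antitone hjn)
    rcases le_or_gt (a (n + 1)) (e y) with hle | hgt
    · rw [hv_eq y n hle hyj]
      simp [hF, h0 n y hy'.le, h1 (n + 1) y hle]
    · refine hv_eq y (n + 1) hy.le fun j hjn => ?_
      rcases Nat.lt_succ_iff_lt_or_eq.1 hjn with hjn | rfl
      · exact hyj j hjn
      · exact hgt

/-- Every Lipschitz function on `X` can be uniformly approximated by `C^k` functions almost
preserving the Lipschitz constants on balls. -/
def HasLipschitzApproximation (k : ℕ∞) (X : Type*) [NormedAddCommGroup X] [NormedSpace ℝ X] :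
    Prop :=
  ∀ f : X → ℝ, (∃ K : ℝ, IsLipschitzWithOn K f Set.univ) → ∀ η : ℝ, 0 < η →
    ∃ g : X → ℝ, ContDiff ℝ k g ∧ (∀ x : X, |f x - g x| ≤ η) ∧
      ∀ (x₀ : X) (r : ℝ), 0 < r →
        lipOn g (closedBall x₀ r) ≤ lipOn f (closedBall x₀ (r + η)) + η

section Smooth

variable {X : Type*} [NormedAddCommGroup X] [NormedSpace ℝ X] {k : ℕ∞}

/-- The local form of the approximation property: the junk value of `lipOn` is harmless on small
balls, where a `C^1` function is Lipschitz. -/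
lemma HasLipschitzApproximation.exists_locally (hX : HasLipschitzApproximation k X) (hk : 1 ≤ k)
    {f : X → ℝ} (hf : ∃ K : ℝ, IsLipschitzWithOn K f univ) {η : ℝ} (hη : 0 < η) (hη1 : η ≤ 1) :
    ∃ g : X → ℝ, ContDiff ℝ k g ∧ (∀ x, |f x - g x| ≤ η) ∧
      ∀ K R p, 0 ≤ K → IsLipschitzWithOn K f (closedBall 0 R) → ‖p‖ + 2 ≤ R →
        ∃ t ∈ 𝓝 p, IsLipschitzWithOn (K + η) g t := by
  obtain ⟨g, hg, hfg, hlip⟩ := hX f hf η hη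
  refine ⟨g, hg, hfg, fun K R p hK hfK hp => ?_⟩
  obtain ⟨C, t, ht, hgt⟩ :=
    (hg.contDiffAt.of_le (by exact_mod_cast hk)).exists_lipschitzOnWith (x := p)
  obtain ⟨r₀, hr₀, hsub⟩ := nhds_basis_closedBall.mem_iff.1 ht
  set r := min r₀ 1
  have hr : 0 < r := by positivity
  refine ⟨closedBall p r, closedBall_mem_nhds p hr, ?_⟩
  have h1 : IsLipschitzWithOn C g (closedBall p r) := fun x hx y hy =>
    hgt.dist_le_mul x (hsub (closedBall_subset_closedBall (min_le_left _ _) hx)) y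
      (hsub (closedBall_subset_closedBall (min_le_left _ _) hy))
  have h2 : closedBall p (r + η) ⊆ closedBall 0 R := by
    refine closedBall_subset_closedBall' ?_
    have : r ≤ 1 := min_le_right _ _
    rw [dist_zero_right]
    linarith
  refine (isLipschitzWithOn_lipOn ⟨_, h1⟩).mono ((hlip p r hr).trans ?_) le_rfl
  exact add_le_add_left (lipOn_le (hfK.mono le_rfl h2) hK) η

/-- `C^k` cutoff functions between the superlevel sets of a `1`-Lipschitz function. -/
lemma HasLipschitzApproximation.exists_cutoff (hX : HasLipschitzApproximation k X) (hk : 1 ≤ k)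
    {e : X → ℝ} (he : IsLipschitzWithOn 1 e univ) {a b : ℝ} (hab : b < a) :
    ∃ χ : X → ℝ, ContDiff ℝ k χ ∧ (∀ x, 0 ≤ χ x) ∧ (∀ x, χ x ≤ 1) ∧ (∀ x, a ≤ e x → χ x = 1) ∧
      (∀ x, e x ≤ b → χ x = 0) ∧
      ∃ C, 0 ≤ C ∧ ∀ p, ∃ t ∈ 𝓝 p, IsLipschitzWithOn C χ t := by
  obtain ⟨M, hM⟩ := exists_lipschitzWith_smoothTransition
  set η := min 1 ((a - b) / 4) with hη
  have hη0 : 0 < η := by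
    have := sub_pos.2 hab
    positivity
  have hη4 : η ≤ (a - b) / 4 := min_le_right _ _
  obtain ⟨g, hg, heg, hlip⟩ := hX.exists_locally hk ⟨1, he⟩ hη0 (min_le_left _ _)
  set D := a - b - 2 * η
  have hD : 0 < D := by simp only [D]; linarith
  refine ⟨fun x => Real.smoothTransition ((g x - (b + η)) / D), ?_,
    fun x => Real.smoothTransition.nonneg _, fun x => Real.smoothTransition.le_one _,
    fun x hx => Real.smoothTransition.one_of_one_le ?_,
    fun x hx => Real.smoothTransition.zero_of_nonpos ?_, M * ((1 + η) / D), by positivity,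
    fun p => ?_⟩
  · exact Real.smoothTransition.contDiff.comp ((hg.sub contDiff_const).div_const D)
  · rw [one_le_div hD]
    have := (abs_le.1 (heg x)).2
    simp only [D]
    linarith
  · refine div_nonpos_of_nonpos_of_nonneg ?_ hD.le
    have := (abs_le.1 (heg x)).1
    linarith
  · obtain ⟨t, ht, hgt⟩ := hlip 1 (‖p‖ + 2) p zero_le_one (he.mono le_rfl (subset_univ _)) le_rfl
    refine ⟨t, ht, fun x hx y hy => ?_⟩
    refine (hM.dist_le_mul _ _).trans ?_
    rw [Real.dist_eq, ← sub_div, sub_sub_sub_cancel_right, abs_div, abs_of_pos hD, mul_assoc]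
    gcongr
    rw [div_mul_eq_mul_div]
    gcongr
    exact hgt x hx y hy

/-- A function whose Lipschitz constant on every ball is smaller than `L` can be approximated by
`L`-Lipschitz functions which are `C^k` on a given open set and unchanged outside of it. -/
lemma HasLipschitzApproximation.exists_contDiffOn (hX : HasLipschitzApproximation k X)
    (hk : 1 ≤ k) {Ω : Set X} (hΩ : IsOpen Ω) {u : X → ℝ} {L ε : ℝ} (hε : 0 < ε)
    (hu : ∀ R, ∃ c, 0 < c ∧ c ≤ L ∧ IsLipschitzWithOn (L - c) u (closedBall 0 R)) :
    ∃ v : X → ℝ, ContDiffOn ℝ k v Ω ∧ IsLipschitzWithOn L v univ ∧ (∀ x ∉ Ω, v x = u x) ∧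
      ∀ x, |u x - v x| ≤ ε := by
  have huL : IsLipschitzWithOn L u univ := by
    intro x _ y _
    obtain ⟨c, hc, -, hcu⟩ := hu (max ‖x‖ ‖y‖)
    exact hcu.mono (by linarith) le_rfl x (by simp) y (by simp)
  obtain ⟨e, he, hepos, hezero, henorm⟩ := hΩ.exists_isLipschitzWithOn_pos
  have hec : Continuous e := (lipschitzOnWith_univ.1 (he.lipschitzOnWith zero_le_one)).continuous
  set a : ℕ → ℝ := fun n => (1 / 2) ^ n with ha
  set b : ℕ → ℝ := fun n => 3 / 4 * a n
  have ha0 : ∀ n, 0 < a n := fun n => by positivity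
  have hab : ∀ n, b n < a n := fun n => by
    have := ha0 n
    simp only [b]
    linarith
  have hba : ∀ n, a (n + 1) < b n := fun n => by
    have := ha0 n
    simp only [b, ha, pow_succ] at this ⊢
    linarith
  choose χ hχ hχ0 hχ1 hχa hχb C hC hχC using fun n => hX.exists_cutoff hk he (hab n)
  choose c hc hcL hcu using fun n : ℕ => hu (1 / a (n + 1) + 2)
  set θ : ℕ → ℝ := fun n => min (min 1 ε) (min (a (n + 1) ^ 2) (c n / (1 + 2 * C n))) with hθ
  have hθ0 : ∀ n, 0 < θ n := fun n => by
    have h1 := hC n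
    have h2 := hc n
    have h3 := ha0 (n + 1)
    positivity
  have hθ1 : ∀ n, θ n ≤ 1 := fun n => (min_le_left _ _).trans (min_le_left _ _)
  have hθε : ∀ n, θ n ≤ ε := fun n => (min_le_left _ _).trans (min_le_right _ _)
  have hθa : ∀ n, θ n ≤ a (n + 1) ^ 2 := fun n => (min_le_right _ _).trans (min_le_left _ _)
  have hθc : ∀ n, (L - c n + θ n) + C n * (2 * θ n) ≤ L := fun n => by
    have h1 : θ n ≤ c n / (1 + 2 * C n) := (min_le_right _ _).trans (min_le_right _ _)
    have h2 : 0 < 1 + 2 * C n := by linarith [hC n]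
    rw [le_div_iff₀ h2] at h1
    linarith
  obtain ⟨η, hη0, hηθ, hηθ'⟩ := exists_pos_le_and_succ_le hθ0
  choose g hg hug hgl using fun n =>
    hX.exists_locally hk ⟨L, huL⟩ (hη0 n) ((hηθ n).trans (hθ1 n))
  obtain ⟨v, hvu, hv⟩ := exists_glue (u := u) (g := g) hec
    (tendsto_pow_atTop_nhds_zero_of_lt_one (by norm_num) (by norm_num)) ha0 hab hba hχa hχb
  have hdist : ∀ x ∈ Ω, |u x - v x| ≤ min ε (e x ^ 2) := by
    intro x hx
    obtain ⟨n, hn, heq⟩ := hv x (hepos x hx)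
    rw [heq.eq_of_nhds]
    refine (abs_sub_combination_le (hχ0 n x) (hχ1 n x) ((hug n x).trans (hηθ n))
      ((hug (n + 1) x).trans (hηθ' n))).trans (le_min (hθε n) ((hθa n).trans ?_))
    have := ha0 (n + 1)
    gcongr
  have hvu' : ∀ x ∉ Ω, v x = u x := fun x hx => hvu x (hezero x hx).le
  refine ⟨v, fun x hx => ?_, isLipschitzWithOn_univ_of_eventually fun p K hK => ?_, hvu',
    fun x => ?_⟩
  · obtain ⟨n, -, heq⟩ := hv x (hepos x hx)
    refine ContDiffAt.contDiffWithinAt (ContDiffAt.congr_of_eventuallyEq ?_ heq)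
    exact (((hχ n).mul (hg n)).add ((contDiff_const.sub (hχ n)).mul (hg (n + 1)))).contDiffAt
  · by_cases hp : p ∈ Ω
    · obtain ⟨n, hn, heq⟩ := hv p (hepos p hp)
      have hpn : ‖p‖ + 2 ≤ 1 / a (n + 1) + 2 := by
        gcongr
        rw [le_div_iff₀ (ha0 _), mul_comm]
        exact (mul_le_mul_of_nonneg_right hn (norm_nonneg p)).trans (henorm p)
      obtain ⟨t₁, ht₁, hgt₁⟩ := hgl n _ _ p (sub_nonneg.2 (hcL n)) (hcu n) hpn
      obtain ⟨t₂, ht₂, hgt₂⟩ := hgl (n + 1) _ _ p (sub_nonneg.2 (hcL n)) (hcu n) hpn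
      obtain ⟨t₃, ht₃, hχt₃⟩ := hχC n p
      filter_upwards [ht₁, ht₂, ht₃, heq] with q hq₁ hq₂ hq₃ hq
      rw [hq, heq.eq_of_nhds]
      refine (abs_combination_sub_le (hχ0 n p) (hχ1 n p)
        (hgt₁.mono (add_le_add_right (hηθ n) _) le_rfl q hq₁ p (mem_of_mem_nhds ht₁))
        (hgt₂.mono (add_le_add_right (hηθ' n) _) le_rfl q hq₂ p (mem_of_mem_nhds ht₂))
        (hχt₃ q hq₃ p (mem_of_mem_nhds ht₃)) ?_ (hθc n) (hC n)).trans
        (mul_le_mul_of_nonneg_right hK.le dist_nonneg)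
      have h1 := abs_le.1 ((hug n q).trans (hηθ n))
      have h2 := abs_le.1 ((hug (n + 1) q).trans (hηθ' n))
      rw [abs_le]
      constructor <;> linarith
    · filter_upwards [closedBall_mem_nhds p (sub_pos.2 hK)] with q hq
      have hq' : dist q p ≤ K - L := hq
      have h1 : |u q - v q| ≤ dist q p ^ 2 := by
        by_cases hqΩ : q ∈ Ω
        · have h2 := he q trivial p trivial
          rw [hezero p hp, sub_zero, one_mul] at h2
          calc |u q - v q| ≤ e q ^ 2 := (hdist q hqΩ).trans (min_le_right _ _)
            _ = |e q| ^ 2 := (sq_abs _).symm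
            _ ≤ _ := by gcongr
        · rw [hvu' q hqΩ, sub_self, abs_zero]
          positivity
      have h2 := huL q trivial p trivial
      rw [hvu' p hp]
      calc |v q - u p| ≤ |v q - u q| + |u q - u p| := abs_sub_le _ _ _
        _ ≤ dist q p ^ 2 + L * dist q p := by rw [abs_sub_comm (v q)]; gcongr
        _ = (dist q p + L) * dist q p := by ring
        _ ≤ K * dist q p := by gcongr; linarith
  · by_cases hx : x ∈ Ω
    · exact (hdist x hx).trans (min_le_left _ _)
    · rw [hvu' x hx, sub_self, abs_zero]
      exact hε.le

end Smooth

/-- Theorem (general approximation result): if `X` is a Banach space where every Lipschitz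
function can be uniformly approximated by `C^k` functions almost preserving the local Lipschitz
constants on balls, then every Lipschitz function `u₀` on the closure of an open set `Ω` with
`lip(u₀, ∂Ω) < lip(u₀, cl Ω)` can be uniformly approximated by functions of class `C^k` on `Ω`
which coincide with `u₀` on `∂Ω` and whose Lipschitz constant does not exceed that of `u₀`. -/
theorem stmt_4 (k : ℕ∞) (hk : 1 ≤ k)
    {X : Type*} [NormedAddCommGroup X] [NormedSpace ℝ X] [CompleteSpace X]
    (hX : ∀ f : X → ℝ, (∃ K : ℝ, IsLipschitzWithOn K f Set.univ) → ∀ η : ℝ, 0 < η →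
      ∃ g : X → ℝ, ContDiff ℝ k g ∧ (∀ x : X, |f x - g x| ≤ η) ∧
        ∀ (x₀ : X) (r : ℝ), 0 < r →
          lipOn g (closedBall x₀ r) ≤ lipOn f (closedBall x₀ (r + η)) + η)
    (Ω : Set X) (hΩ : IsOpen Ω) (u₀ : X → ℝ)
    (hu₀ : ∃ K : ℝ, IsLipschitzWithOn K u₀ (closure Ω))
    (hlt : lipOn u₀ (frontier Ω) < lipOn u₀ (closure Ω))
    (ε : ℝ) (hε : 0 < ε) :
    ∃ v : X → ℝ,
      ContDiffOn ℝ k v Ω ∧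
      IsLipschitzWithOn (lipOn u₀ (closure Ω)) v (closure Ω) ∧
      lipOn v (closure Ω) ≤ lipOn u₀ (closure Ω) ∧
      (∀ x ∈ frontier Ω, v x = u₀ x) ∧
      (∀ x ∈ closure Ω, |u₀ x - v x| ≤ ε) := by
  have hL : IsLipschitzWithOn (lipOn u₀ (closure Ω)) u₀ (closure Ω) := isLipschitzWithOn_lipOn hu₀
  have hL' : IsLipschitzWithOn (lipOn u₀ (frontier Ω)) u₀ (frontier Ω) :=
    isLipschitzWithOn_lipOn ⟨_, hL.mono le_rfl frontier_subset_closure⟩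
  obtain ⟨f, hf, hfu⟩ := (hL.lipschitzOnWith (lipOn_nonneg _ _)).extend_real
  obtain ⟨w, hw, hwu⟩ := (hL'.lipschitzOnWith (lipOn_nonneg _ _)).extend_real
  obtain ⟨u, huf, hfu', hu⟩ := exists_isLipschitzWithOn_lt (lipOn_nonneg _ _) hlt (half_pos hε)
    (hf.isLipschitzWithOn univ) (hw.isLipschitzWithOn univ)
  have hX' : HasLipschitzApproximation k X := hX
  obtain ⟨v, hv, hvL, hvu, huv⟩ := hX'.exists_contDiffOn hk hΩ (half_pos hε) hu
  have hvc : IsLipschitzWithOn (lipOn u₀ (closure Ω)) v (closure Ω) :=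
    hvL.mono le_rfl (subset_univ _)
  refine ⟨v, hv, hvc, lipOn_le hvc (lipOn_nonneg _ _), fun x hx => ?_, fun x hx => ?_⟩
  · have hxΩ : x ∉ Ω := fun h => (hΩ.inter_frontier_eq ▸ ⟨h, hx⟩ : x ∈ (∅ : Set X))
    have hfx := hfu (frontier_subset_closure hx)
    rw [hvu x hxΩ, huf x (hfx.symm.trans (hwu hx)), hfx]
  · rw [hfu hx]
    calc |f x - v x| ≤ |f x - u x| + |u x - v x| := abs_sub_le _ _ _
      _ ≤ ε / 2 + ε / 2 := add_le_add (hfu' x) (huv x)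
      _ = ε := add_halves ε
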